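/- For p = 2 and any fixed odd positive integer k, the average of M_μ^{(k)} over partitions μ of n satisfies E_{μ⊢n} M_μ^{(k)} = (√6/(2π log 2))·√n·log n·(1 + o_k(1)) as n → ∞. -/

import Mathlib

open Real Filter
open scoped BigOperators

/-- `M_μ^{(k)}` (for `p = 2`): the sum of the parts of `μ` of the form `k·2^j`. -/
noncomputable def Msum (p k : ℕ) (s : Multiset ℕ) : ℕ :=
  letI := Classical.decPred fun a : ℕ => ∃ j : ℕ, a = k * p ^ j
  (s.filter fun a : ℕ => ∃ j : ℕ, a = k * p ^ j).sum

/-- number of partitions -/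
noncomputable def pc (n : ℕ) : ℝ := (Fintype.card (Nat.Partition n) : ℝ)

/-- total multiplicity of the part `a` -/
noncomputable def cnt (a n : ℕ) : ℝ := ∑ μ : Nat.Partition n, (μ.parts.count a : ℝ)

/-- adding a part -/
def addPart (a n : ℕ) (ha : 0 < a) (ν : Nat.Partition n) : Nat.Partition (n + a) where
  parts := a ::ₘ ν.parts
  parts_pos := by
    intro i hi
    rcases Multiset.mem_cons.1 hi with h | h
    · omega
    · exact ν.parts_pos h
  parts_sum := by rw [Multiset.sum_cons, ν.parts_sum, add_comm]

lemma addPart_inj (a n : ℕ) (ha : 0 < a) : Function.Injective (addPart a n ha) := by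
  intro x y h
  have := congrArg Nat.Partition.parts h
  simp only [addPart, Multiset.cons_inj_right] at this
  exact Nat.Partition.ext this

lemma pc_mono (n : ℕ) : pc n ≤ pc (n + 1) := by
  unfold pc
  exact_mod_cast Fintype.card_le_of_injective _ (addPart_inj 1 n one_pos)

lemma pc_zero : pc 0 = 1 := by simp [pc]

lemma pc_one_le (n : ℕ) : 1 ≤ pc n := by
  induction n with
  | zero => rw [pc_zero]
  | succ n ih => exact ih.trans (pc_mono n)

lemma part_le {n : ℕ} (μ : Nat.Partition n) {a : ℕ} (h : a ∈ μ.parts) : a ≤ n := by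
  have := Multiset.single_le_sum (fun x _ => Nat.zero_le x) a h
  rwa [μ.parts_sum] at this

lemma cnt_lt {a n : ℕ} (h : n < a) : cnt a n = 0 := by
  unfold cnt
  refine Finset.sum_eq_zero fun μ _ => ?_
  rw [Multiset.count_eq_zero_of_notMem, Nat.cast_zero]
  intro hm
  have := part_le μ hm
  omega

lemma cnt_add {a : ℕ} (ha : 0 < a) (n : ℕ) : cnt a (n + a) = pc n + cnt a n := by
  unfold cnt pc
  rw [← Fintype.sum_of_injective (addPart a n ha) (addPart_inj a n ha)
    (fun ν => (1 : ℝ) + (ν.parts.count a : ℝ))]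
  · rw [Finset.sum_add_distrib]; simp
  · intro μ hμ
    rw [Multiset.count_eq_zero_of_notMem, Nat.cast_zero]
    intro hm
    apply hμ
    refine ⟨⟨μ.parts.erase a, fun hi => μ.parts_pos (Multiset.mem_of_mem_erase hi), ?_⟩, ?_⟩
    · have := Multiset.sum_erase hm
      rw [μ.parts_sum] at this
      omega
    · apply Nat.Partition.ext
      simp only [addPart]
      exact Multiset.cons_erase hm
  · intro ν
    simp [addPart]; ring

/-- differences -/
noncomputable def dd : ℕ → ℝ
  | 0 => 1
  | n + 1 => pc (n + 1) - pc n

lemma dd_nonneg (n : ℕ) : 0 ≤ dd n := by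
  cases n with
  | zero => simp [dd]
  | succ n => simp only [dd]; linarith [pc_mono n]

/-- the functional -/
noncomputable def LL (n : ℕ) (f : ℕ → ℝ) : ℝ := ∑ w ∈ Finset.range (n + 1), dd w * f (n - w)

lemma LL_mono {n : ℕ} {f g : ℕ → ℝ} (h : ∀ x ≤ n, f x ≤ g x) : LL n f ≤ LL n g := by
  unfold LL
  exact Finset.sum_le_sum fun w _ => mul_le_mul_of_nonneg_left (h _ (Nat.sub_le _ _)) (dd_nonneg w)

lemma LL_congr {n : ℕ} {f g : ℕ → ℝ} (h : ∀ x ≤ n, f x = g x) : LL n f = LL n g :=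
  le_antisymm (LL_mono fun x hx => (h x hx).le) (LL_mono fun x hx => (h x hx).ge)

lemma LL_add (n : ℕ) (f g : ℕ → ℝ) : LL n (fun x => f x + g x) = LL n f + LL n g := by
  simp [LL, mul_add, Finset.sum_add_distrib]

lemma LL_smul (n : ℕ) (c : ℝ) (f : ℕ → ℝ) : LL n (fun x => c * f x) = c * LL n f := by
  simp only [LL, Finset.mul_sum]
  exact Finset.sum_congr rfl fun _ _ => by ring

lemma LL_sum {ι : Type} (n : ℕ) (s : Finset ι) (f : ι → ℕ → ℝ) :
    LL n (fun x => ∑ i ∈ s, f i x) = ∑ i ∈ s, LL n (f i) := by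
  simp only [LL, Finset.mul_sum]
  exact Finset.sum_comm

lemma LL_one (n : ℕ) : LL n (fun _ => 1) = pc n := by
  unfold LL
  induction n with
  | zero => simp [dd, pc_zero]
  | succ n ih => rw [Finset.sum_range_succ, ih]; simp [dd]

/-- step -/
lemma LL_succ (n : ℕ) (f : ℕ → ℝ) :
    LL (n + 1) f = LL n (fun x => f (x + 1)) + dd (n + 1) * f 0 := by
  unfold LL
  rw [Finset.sum_range_succ, Nat.sub_self]
  congr 1
  refine Finset.sum_congr rfl fun w hw => ?_
  rw [Nat.sub_add_comm (by have := Finset.mem_range.1 hw; omega)]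

/-- first sum -/
noncomputable def PP (n : ℕ) : ℝ := LL n (fun x => (x : ℝ) + 1)
/-- second sum -/
noncomputable def QQ (n : ℕ) : ℝ := LL n (fun x => ((x : ℝ) + 1) * (x + 2) / 2)

lemma PP_succ (n : ℕ) : PP (n + 1) = PP n + pc (n + 1) := by
  unfold PP
  rw [LL_succ, ← LL_one (n+1), LL_succ, ← add_assoc, ← LL_add]
  simp

lemma QQ_succ (n : ℕ) : QQ (n + 1) = QQ n + PP (n + 1) := by
  unfold QQ PP
  rw [LL_succ, LL_succ, ← add_assoc, ← LL_add]
  congr 1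
  · congr 1; funext x; push_cast; ring
  · norm_num

lemma cnt_eq {a : ℕ} (ha : 0 < a) (n : ℕ) : cnt a n = LL n (fun x => ((x / a : ℕ) : ℝ)) := by
  induction n using Nat.strong_induction_on with
  | _ n ih =>
    rcases lt_or_ge n a with h | h
    · rw [cnt_lt h]
      symm
      unfold LL
      refine Finset.sum_eq_zero fun w _ => ?_
      beta_reduce
      rw [Nat.div_eq_of_lt (by omega)]; simp
    · obtain ⟨m, rfl⟩ := Nat.exists_eq_add_of_le' h
      rw [cnt_add ha, ih m (by omega), ← LL_one m, ← LL_add]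
      unfold LL
      rw [show m + a + 1 = (m + 1) + a by ring, Finset.sum_range_add _ (m+1) a]
      rw [Finset.sum_eq_zero (s := Finset.range a), add_zero]
      · refine Finset.sum_congr rfl fun w hw => ?_
        have := Finset.mem_range.1 hw
        beta_reduce
        rw [show m + a - w = (m - w) + a by omega, Nat.add_div_right _ ha]
        push_cast; ring
      · intro w hw
        have := Finset.mem_range.1 hw
        beta_reduce
        rw [Nat.div_eq_of_lt (by omega)]; simp

lemma sum_filter_eq {n : ℕ} (p : ℕ → Prop) [DecidablePred p] (μ : Nat.Partition n) :
    (((μ.parts.filter p).sum : ℕ) : ℝ) =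
      ∑ a ∈ (Finset.Icc 1 n).filter p, (a : ℝ) * (μ.parts.count a : ℝ) := by
  rw [Finset.sum_multiset_count_of_subset (μ.parts.filter p) ((Finset.Icc 1 n).filter p)]
  · push_cast
    refine Finset.sum_congr rfl fun a ha => ?_
    rw [Multiset.count_filter_of_pos (Finset.mem_filter.1 ha).2]
    simp [mul_comm]
  · intro a ha
    have h := Multiset.mem_toFinset.1 ha
    rw [Multiset.mem_filter] at h
    simp only [Finset.mem_filter, Finset.mem_Icc]
    exact ⟨⟨μ.parts_pos h.1, part_le μ h.1⟩, h.2⟩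

lemma sum_filter_LL (n : ℕ) (p : ℕ → Prop) [DecidablePred p] :
    ∑ μ : Nat.Partition n, (((μ.parts.filter p).sum : ℕ) : ℝ) =
      LL n (fun x => ∑ a ∈ (Finset.Icc 1 n).filter p, (a : ℝ) * ((x / a : ℕ) : ℝ)) := by
  simp_rw [sum_filter_eq]
  rw [Finset.sum_comm, LL_sum]
  refine Finset.sum_congr rfl fun a ha => ?_
  rw [LL_smul, ← cnt_eq (Finset.mem_Icc.1 (Finset.mem_filter.1 ha).1).1, cnt, Finset.mul_sum]

/-- summatory divisor function -/
noncomputable def SS (x : ℕ) : ℝ := ∑ m ∈ Finset.Icc 1 x, ((x / m : ℕ) : ℝ) * ((x / m : ℕ) + 1) / 2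

lemma gauss (n : ℕ) : ∑ a ∈ Finset.Icc 1 n, (a : ℝ) = (n : ℝ) * (n + 1) / 2 := by
  induction n with
  | zero => simp
  | succ n ih => rw [Finset.sum_Icc_succ_top (by omega), ih]; push_cast; ring

lemma SS_eq {x n : ℕ} (h : x ≤ n) :
    ∑ a ∈ Finset.Icc 1 n, (a : ℝ) * ((x / a : ℕ) : ℝ) = SS x := by
  have h1 : ∀ a ∈ Finset.Icc 1 n, (a : ℝ) * ((x / a : ℕ) : ℝ) =
      ∑ m ∈ Finset.Icc 1 x, if m * a ≤ x then (a : ℝ) else 0 := by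
    intro a ha
    have ha' := (Finset.mem_Icc.1 ha).1
    rw [← Finset.sum_filter]
    have : (Finset.Icc 1 x).filter (fun m => m * a ≤ x) = Finset.Icc 1 (x / a) := by
      ext m
      simp only [Finset.mem_filter, Finset.mem_Icc, Nat.le_div_iff_mul_le ha']
      constructor
      · rintro ⟨⟨h1, h2⟩, h3⟩; exact ⟨h1, h3⟩
      · rintro ⟨h1, h3⟩; exact ⟨⟨h1, by nlinarith⟩, h3⟩
    rw [this]; simp [mul_comm]
  rw [Finset.sum_congr rfl h1, Finset.sum_comm]
  unfold SS
  refine Finset.sum_congr rfl fun m hm => ?_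
  have hm' := (Finset.mem_Icc.1 hm).1
  rw [← Finset.sum_filter, ← gauss]
  congr 1
  ext a
  simp only [Finset.mem_filter, Finset.mem_Icc, Nat.le_div_iff_mul_le hm']
  constructor
  · rintro ⟨⟨h1, h2⟩, h3⟩; exact ⟨h1, by linarith⟩
  · rintro ⟨h1, h3⟩; exact ⟨⟨h1, by nlinarith⟩, by linarith⟩

lemma n_pc (n : ℕ) : (n : ℝ) * pc n = LL n SS := by
  have h := sum_filter_LL n (fun _ => True)
  simp only [Multiset.filter_true, Nat.Partition.parts_sum, Finset.filter_true] at h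
  rw [← LL_congr (fun x hx => SS_eq hx), ← h]
  simp [pc, mul_comm]

lemma div_lim (m : ℕ) (hm : 0 < m) :
    Tendsto (fun x : ℕ => ((x / m : ℕ) : ℝ) / ((x : ℝ) + 1)) atTop (nhds (1 / m)) := by
  rw [tendsto_iff_norm_sub_tendsto_zero]
  refine squeeze_zero (fun _ => norm_nonneg _) (fun x => ?_) tendsto_one_div_add_atTop_nhds_zero_nat
  have h1 : ((x / m : ℕ) : ℝ) * m ≤ x := by exact_mod_cast Nat.div_mul_le_self x m
  have h2 : (x : ℝ) + 1 ≤ ((x / m : ℕ) : ℝ) * m + m := by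
    have := Nat.lt_div_mul_add (a := x) hm
    exact_mod_cast this
  have hm' : (0 : ℝ) < m := by exact_mod_cast hm
  have hx : (0 : ℝ) < (x : ℝ) + 1 := by positivity
  rw [Real.norm_eq_abs, div_sub_div _ _ hx.ne' hm'.ne', abs_div, abs_of_pos (mul_pos hx hm'),
    div_le_div_iff₀ (mul_pos hx hm') hx, abs_of_nonpos (by linarith)]
  nlinarith

lemma div_lim2 (m : ℕ) (hm : 0 < m) :
    Tendsto (fun x : ℕ => (((x / m : ℕ) : ℝ) + 1) / ((x : ℝ) + 2)) atTop (nhds (1 / m)) := by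
  rw [tendsto_iff_norm_sub_tendsto_zero]
  refine squeeze_zero (fun _ => norm_nonneg _) (fun x => ?_) tendsto_one_div_add_atTop_nhds_zero_nat
  have h1 : ((x / m : ℕ) : ℝ) * m ≤ x := by exact_mod_cast Nat.div_mul_le_self x m
  have h2 : (x : ℝ) + 1 ≤ ((x / m : ℕ) : ℝ) * m + m := by
    have := Nat.lt_div_mul_add (a := x) hm
    exact_mod_cast this
  have hm' : (1 : ℝ) ≤ m := by exact_mod_cast hm
  have hm0 : (0 : ℝ) < m := by linarith
  have hx : (0 : ℝ) < (x : ℝ) + 1 := by positivity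
  have hx2 : (0 : ℝ) < (x : ℝ) + 2 := by positivity
  rw [Real.norm_eq_abs, div_sub_div _ _ hx2.ne' hm0.ne', abs_div, abs_of_pos (mul_pos hx2 hm0),
    div_le_div_iff₀ (mul_pos hx2 hm0) hx]
  have : |(((x / m : ℕ) : ℝ) + 1) * m - ((x : ℝ) + 2) * 1| ≤ m := by
    rw [abs_le]; constructor <;> linarith
  nlinarith

/-- triangular weight -/
noncomputable def TT (x : ℕ) : ℝ := ((x : ℝ) + 1) * (x + 2) / 2

lemma TT_pos (x : ℕ) : 0 < TT x := by unfold TT; positivity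

lemma TT_one_le (x : ℕ) : 1 ≤ TT x := by
  unfold TT
  have : (0 : ℝ) ≤ x := x.cast_nonneg
  nlinarith

lemma SS_lim : Tendsto (fun x : ℕ => SS x / TT x) atTop (nhds (π ^ 2 / 6)) := by
  have key : ∀ x : ℕ, SS x / TT x = ∑' m : ℕ, (((x / m : ℕ) : ℝ) / ((x : ℝ) + 1)) *
      ((((x / m : ℕ) : ℝ) + 1) / ((x : ℝ) + 2)) := by
    intro x
    rw [tsum_eq_sum (s := Finset.Icc 1 x)]
    · unfold SS TT
      rw [Finset.sum_div]
      refine Finset.sum_congr rfl fun m _ => ?_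
      have hx : (0 : ℝ) < (x : ℝ) + 1 := by positivity
      have hx2 : (0 : ℝ) < (x : ℝ) + 2 := by positivity
      field_simp
    · intro m hm
      have : x / m = 0 := by
        rw [Nat.div_eq_zero_iff]
        simp only [Finset.mem_Icc] at hm
        omega
      simp [this]
  simp_rw [key]
  rw [← hasSum_zeta_two.tsum_eq]
  refine tendsto_tsum_of_dominated_convergence (bound := fun m : ℕ => 2 * (1 / (m : ℝ) ^ 2))
    (hasSum_zeta_two.summable.mul_left 2) ?_ ?_
  · intro m
    rcases Nat.eq_zero_or_pos m with rfl | hm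
    · simp
    · have := (div_lim m hm).mul (div_lim2 m hm)
      refine this.congr' (Eventually.of_forall fun _ => rfl) |>.trans ?_
      rw [div_mul_div_comm, one_mul, sq]
  · refine Eventually.of_forall fun x m => ?_
    have hx : (0 : ℝ) < (x : ℝ) + 1 := by positivity
    have hx2 : (0 : ℝ) < (x : ℝ) + 2 := by positivity
    rw [Real.norm_of_nonneg (by positivity)]
    rcases Nat.eq_zero_or_pos (x / m) with h | h
    · rw [h]; simp
    · have hm : 0 < m := by
        rcases Nat.eq_zero_or_pos m with rfl | hm
        · simp at h
        · exact hm
      have hm' : (0 : ℝ) < m := by exact_mod_cast hm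
      have h1 : ((x / m : ℕ) : ℝ) * m ≤ x := by exact_mod_cast Nat.div_mul_le_self x m
      have h2 : (1 : ℝ) ≤ ((x / m : ℕ) : ℝ) := by exact_mod_cast h
      have e1 : ((x / m : ℕ) : ℝ) / ((x : ℝ) + 1) ≤ 1 / m := by
        rw [div_le_div_iff₀ hx hm']; linarith
      have e2 : (((x / m : ℕ) : ℝ) + 1) / ((x : ℝ) + 2) ≤ 2 / m := by
        rw [div_le_div_iff₀ hx2 hm']; nlinarith
      calc _ ≤ (1 / (m : ℝ)) * (2 / m) := by gcongr
        _ = _ := by field_simp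

lemma QQ_eq (n : ℕ) : QQ n = LL n TT := rfl

lemma pc_pos (n : ℕ) : 0 < pc n := by linarith [pc_one_le n]

lemma PP_ge (n : ℕ) : pc n ≤ PP n := by
  rw [← LL_one]; unfold PP
  exact LL_mono fun x _ => by linarith [(x.cast_nonneg : (0 : ℝ) ≤ x)]

lemma PP_le_QQ (n : ℕ) : PP n ≤ QQ n := by
  unfold PP QQ
  refine LL_mono fun x _ => ?_
  have : (0 : ℝ) ≤ x := x.cast_nonneg
  nlinarith

lemma QQ_ge (n : ℕ) : (n : ℝ) + 1 ≤ QQ n := by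
  induction n with
  | zero => simpa using (pc_one_le 0).trans ((PP_ge 0).trans (PP_le_QQ 0))
  | succ n ih => rw [QQ_succ]; push_cast; linarith [pc_one_le (n+1), PP_ge (n+1)]

lemma QQ_pos (n : ℕ) : 0 < QQ n := by
  have := QQ_ge n
  have : (0 : ℝ) ≤ n := n.cast_nonneg
  linarith

lemma npc_lim : Tendsto (fun n : ℕ => (n : ℝ) * pc n / QQ n) atTop (nhds (π ^ 2 / 6)) := by
  obtain ⟨K, hK⟩ := SS_lim.bddAbove_range
  have hK' : ∀ x, SS x ≤ K * TT x := fun x => by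
    have := hK ⟨x, rfl⟩
    exact (div_le_iff₀ (TT_pos x)).1 this
  have hb : ∀ n : ℕ, (n : ℝ) * pc n ≤ K * QQ n := fun n => by
    rw [n_pc, QQ_eq, ← LL_smul]
    exact LL_mono fun x _ => hK' x
  set z := π ^ 2 / 6 with hz
  rw [Metric.tendsto_atTop]
  intro ε hε
  obtain ⟨V, hV⟩ := (Metric.tendsto_atTop.1 SS_lim) (ε / 2) (by positivity)
  set C := ∑ x ∈ Finset.range V, |SS x - z * TT x| with hC
  have hC0 : 0 ≤ C := Finset.sum_nonneg fun _ _ => abs_nonneg _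
  have hall : ∀ x, |SS x - z * TT x| ≤ ε / 2 * TT x + C * 1 := by
    intro x
    have hT := TT_pos x
    rcases lt_or_ge x V with h | h
    · have := Finset.single_le_sum (f := fun x => |SS x - z * TT x|) (fun _ _ => abs_nonneg _)
        (Finset.mem_range.2 h)
      have h0 : 0 ≤ ε / 2 * TT x := by positivity
      linarith
    · have := hV x h
      rw [Real.dist_eq] at this
      have e : SS x - z * TT x = (SS x / TT x - z) * TT x := by field_simp
      rw [e, abs_mul, abs_of_pos hT]
      nlinarith
  have hn : ∀ n : ℕ, |(n : ℝ) * pc n - z * QQ n| ≤ ε / 2 * QQ n + C * pc n := by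
    intro n
    rw [n_pc, QQ_eq, ← LL_one n, abs_le]
    constructor
    · have : LL n (fun x => z * TT x) ≤ LL n (fun x => SS x + (ε / 2 * TT x + C * 1)) :=
        LL_mono fun x _ => by linarith [(abs_le.1 (hall x)).1]
      rw [LL_add, LL_add, LL_smul, LL_smul, LL_smul] at this
      linarith
    · have : LL n SS ≤ LL n (fun x => z * TT x + (ε / 2 * TT x + C * 1)) :=
        LL_mono fun x _ => by linarith [(abs_le.1 (hall x)).2]
      rw [LL_add, LL_add, LL_smul, LL_smul, LL_smul] at this
      linarith
  obtain ⟨N, hN⟩ := exists_nat_gt (C * K / (ε / 2))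
  refine ⟨N + 1, fun n hnN => ?_⟩
  have hQ := QQ_pos n
  have hp := pc_pos n
  have hn0 : (0 : ℝ) < n := by exact_mod_cast (by omega : 0 < n)
  have hnN' : (N : ℝ) < n := by exact_mod_cast (by omega : N < n)
  rw [div_lt_iff₀ (by positivity)] at hN
  have h1 : C * pc n < ε / 2 * QQ n := by
    have a1 : C * (n * pc n) ≤ C * (K * QQ n) := mul_le_mul_of_nonneg_left (hb n) hC0
    have a2 : C * K < n * (ε / 2) := by nlinarith
    have a3 : C * K * QQ n < n * (ε / 2) * QQ n := mul_lt_mul_of_pos_right a2 hQ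
    have : n * (C * pc n) < n * (ε / 2 * QQ n) := by nlinarith
    exact lt_of_mul_lt_mul_left this hn0.le
  rw [Real.dist_eq]
  have e : (n : ℝ) * pc n / QQ n - z = ((n : ℝ) * pc n - z * QQ n) / QQ n := by field_simp
  rw [e, abs_div, abs_of_pos hQ, div_lt_iff₀ hQ]
  linarith [hn n]

/-- drift identity -/
lemma drift (b b' : ℝ) (n : ℕ) : (PP (n+1) - b * QQ (n+1)) * (1 + b) =
    (PP n - b' * QQ n) + (pc (n+1) - b ^ 2 * QQ (n+1) + (b' - b) * QQ n) := by
  rw [PP_succ, QQ_succ, PP_succ]; ring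

lemma slope_diff {B δ s t : ℝ} (hB0 : 0 < B) (hδ0 : 0 < δ) (hs0 : 0 < s) (hst : s ≤ t)
    (hsq : t ^ 2 = s ^ 2 + 1) (hs1 : 1 ≤ s ^ 2) (h2 : 4 * B < s * δ) :
    B / s - B / t ≤ (δ / 2) / t ^ 2 := by
  have ht0 : 0 < t := by linarith
  have q1 : (t - s) * (t + s) = 1 := by nlinarith
  have q4 : (t - s) * t ≤ 1 := by nlinarith
  rw [div_sub_div _ _ hs0.ne' ht0.ne', div_le_div_iff₀ (by positivity) (by positivity)]
  have q5 : B * ((t - s) * t) ≤ B * 1 := mul_le_mul_of_nonneg_left q4 hB0.le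
  have q7 : B * ((t - s) * t) ≤ δ / 2 * s := by nlinarith
  calc (B * t - s * B) * t ^ 2 = (B * ((t - s) * t)) * t := by ring
    _ ≤ (δ / 2 * s) * t := mul_le_mul_of_nonneg_right q7 ht0.le
    _ = _ := by ring

lemma step_up {A A' b E K : ℝ} (hb : 0 < b) (hK : 0 ≤ K) (hE : E ≤ 0) (hA : A ≤ K)
    (h : A' * (1 + b) = A + E) : A' ≤ K := by
  by_contra hcon
  have hcon := not_le.1 hcon
  nlinarith

lemma step_down {A A' b E K : ℝ} (hb : 0 < b) (hK : K ≤ 0) (hE : 0 ≤ E) (hA : K ≤ A)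
    (h : A' * (1 + b) = A + E) : K ≤ A' := by
  by_contra hcon
  have hcon := not_le.1 hcon
  nlinarith

lemma PQ_upper {B : ℝ} (hB0 : 0 < B) (hB : π ^ 2 / 6 < B ^ 2) :
    ∃ K : ℝ, ∀ᶠ n : ℕ in atTop, PP n - B / √n * QQ n ≤ K := by
  set z := π ^ 2 / 6
  set δ := B ^ 2 - z with hδ
  have hδ0 : 0 < δ := by linarith
  have e1 : ∀ᶠ n : ℕ in atTop, (n : ℝ) * pc n / QQ n < z + δ / 2 :=
    npc_lim.eventually (gt_mem_nhds (show z < z + δ / 2 by linarith))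
  have e2 : ∀ᶠ n : ℕ in atTop, 4 * B / δ < √(n : ℝ) :=
    (Real.tendsto_sqrt_atTop.comp tendsto_natCast_atTop_atTop).eventually (eventually_gt_atTop _)
  obtain ⟨N, hN⟩ := eventually_atTop.1 (e1.and e2)
  refine ⟨max (PP (N+1) - B / √((N+1 : ℕ) : ℝ) * QQ (N+1)) 0, eventually_atTop.2 ⟨N+1, fun n hn => ?_⟩⟩
  induction n, hn using Nat.le_induction with
  | base => exact le_max_left _ _
  | succ n hn ih =>
    set K := max (PP (N+1) - B / √((N+1 : ℕ) : ℝ) * QQ (N+1)) 0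
    have hK : 0 ≤ K := le_max_right _ _
    obtain ⟨h1, -⟩ := hN (n+1) (by omega)
    obtain ⟨-, h2⟩ := hN n (by omega)
    have hn0 : (0 : ℝ) < n := by exact_mod_cast (by omega : 0 < n)
    have hQ := QQ_pos (n+1)
    have hQn := QQ_pos n
    have hQle : QQ n ≤ QQ (n+1) := by
      rw [QQ_succ]; linarith [PP_ge (n+1), pc_pos (n+1)]
    rw [div_lt_iff₀ hQ] at h1
    rw [div_lt_iff₀ hδ0] at h2
    push_cast at h1 ⊢
    set s := √(n : ℝ) with hs
    set t := √((n : ℝ) + 1) with ht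
    have hs0 : 0 < s := Real.sqrt_pos.2 hn0
    have hss : s ^ 2 = n := Real.sq_sqrt hn0.le
    have htt : t ^ 2 = n + 1 := Real.sq_sqrt (by linarith)
    have hst : s ≤ t := Real.sqrt_le_sqrt (by linarith)
    have ht0 : 0 < t := by linarith
    have hd := drift (B / t) (B / s) n
    -- difference of slopes
    have hdiff : B / s - B / t ≤ (δ / 2) / t ^ 2 :=
      slope_diff hB0 hδ0 hs0 hst (by linarith) (by
        have : (1 : ℝ) ≤ n := by exact_mod_cast (by omega : 1 ≤ n)
        linarith) h2
    have hdn : 0 ≤ B / s - B / t := sub_nonneg.2 (div_le_div_of_nonneg_left hB0.le hs0 hst)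
    have hneg : pc (n+1) - (B / t) ^ 2 * QQ (n+1) + (B / s - B / t) * QQ n ≤ 0 := by
      have r1 : (B / s - B / t) * QQ n ≤ (δ / 2) / t ^ 2 * QQ (n+1) :=
        mul_le_mul hdiff hQle hQn.le (by positivity)
      have r2 : pc (n+1) ≤ (z + δ / 2) / t ^ 2 * QQ (n+1) := by
        rw [div_mul_eq_mul_div, le_div_iff₀ (by positivity), htt]
        linarith
      have r3 : (B / t) ^ 2 * QQ (n+1) = (z + δ / 2) / t ^ 2 * QQ (n+1) + (δ / 2) / t ^ 2 * QQ (n+1) := by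
        rw [div_pow, ← add_mul, ← add_div]; congr 2; simp only [hδ]; ring
      linarith
    exact step_up (div_pos hB0 ht0) hK hneg ih hd

lemma PQ_lower {B : ℝ} (hB0 : 0 < B) (hB : B ^ 2 < π ^ 2 / 6) :
    ∃ K : ℝ, ∀ᶠ n : ℕ in atTop, K ≤ PP n - B / √n * QQ n := by
  have e1 : ∀ᶠ n : ℕ in atTop, B ^ 2 < (n : ℝ) * pc n / QQ n :=
    npc_lim.eventually (lt_mem_nhds hB)
  obtain ⟨N, hN⟩ := eventually_atTop.1 e1
  refine ⟨min (PP (N+1) - B / √((N+1 : ℕ) : ℝ) * QQ (N+1)) 0, eventually_atTop.2 ⟨N+1, fun n hn => ?_⟩⟩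
  induction n, hn using Nat.le_induction with
  | base => exact min_le_left _ _
  | succ n hn ih =>
    set K := min (PP (N+1) - B / √((N+1 : ℕ) : ℝ) * QQ (N+1)) 0
    have hK : K ≤ 0 := min_le_right _ _
    have h1 := hN (n+1) (by omega)
    have hn0 : (0 : ℝ) < n := by exact_mod_cast (by omega : 0 < n)
    have hQ := QQ_pos (n+1)
    have hQn := QQ_pos n
    rw [lt_div_iff₀ hQ] at h1
    push_cast at h1 ⊢
    set s := √(n : ℝ) with hs
    set t := √((n : ℝ) + 1) with ht
    have hs0 : 0 < s := Real.sqrt_pos.2 hn0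
    have htt : t ^ 2 = n + 1 := Real.sq_sqrt (by linarith)
    have hst : s ≤ t := Real.sqrt_le_sqrt (by linarith)
    have ht0 : 0 < t := by linarith
    have hd := drift (B / t) (B / s) n
    have hdn : 0 ≤ B / s - B / t := sub_nonneg.2 (div_le_div_of_nonneg_left hB0.le hs0 hst)
    have hpos : 0 ≤ pc (n+1) - (B / t) ^ 2 * QQ (n+1) + (B / s - B / t) * QQ n := by
      have r1 : 0 ≤ (B / s - B / t) * QQ n := mul_nonneg hdn hQn.le
      have r2 : (B / t) ^ 2 * QQ (n+1) ≤ pc (n+1) := by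
        rw [div_pow, div_mul_eq_mul_div, div_le_iff₀ (by positivity), htt]
        linarith
      linarith
    exact step_down (div_pos hB0 ht0) hK hpos ih hd

lemma sqrt_div_QQ : Tendsto (fun n : ℕ => √(n : ℝ) / QQ n) atTop (nhds 0) := by
  have h : Tendsto (fun n : ℕ => (√(n : ℝ))⁻¹) atTop (nhds 0) :=
    (Real.tendsto_sqrt_atTop.comp tendsto_natCast_atTop_atTop).inv_tendsto_atTop
  refine squeeze_zero' (Eventually.of_forall fun n => div_nonneg (Real.sqrt_nonneg _) (QQ_pos n).le)
    ?_ h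
  filter_upwards [eventually_gt_atTop 0] with n hn
  have hn0 : (0 : ℝ) < n := by exact_mod_cast hn
  have hs : 0 < √(n : ℝ) := Real.sqrt_pos.2 hn0
  rw [inv_eq_one_div, div_le_div_iff₀ (QQ_pos n) hs, Real.mul_self_sqrt hn0.le]
  linarith [QQ_ge n]

lemma PQ_lim : Tendsto (fun n : ℕ => √(n : ℝ) * PP n / QQ n) atTop (nhds (π / √6)) := by
  have h6 : (0 : ℝ) < √6 := by positivity
  have hc : 0 < π / √6 := by positivity
  have hc2 : (π / √6) ^ 2 = π ^ 2 / 6 := by rw [div_pow, Real.sq_sqrt (by norm_num)]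
  rw [tendsto_order]
  constructor
  · intro a ha
    obtain ⟨B, hB1, hB2⟩ := exists_between (max_lt ha hc)
    have hB0 : 0 < B := (le_max_right _ _).trans_lt hB1
    have haB : a < B := (le_max_left _ _).trans_lt hB1
    obtain ⟨K, hK⟩ := PQ_lower hB0 (by rw [← hc2]; gcongr)
    have := (sqrt_div_QQ.const_mul K)
    rw [mul_zero] at this
    filter_upwards [hK, this.eventually (lt_mem_nhds (show a - B < 0 by linarith)),
      eventually_gt_atTop 0] with n h1 h2 hn
    have hn0 : (0 : ℝ) < n := by exact_mod_cast hn
    have hs : 0 < √(n : ℝ) := Real.sqrt_pos.2 hn0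
    have hQ := QQ_pos n
    have e : √(n : ℝ) * PP n / QQ n = B + (PP n - B / √n * QQ n) * (√n / QQ n) := by
      field_simp; ring
    have : K * (√n / QQ n) ≤ (PP n - B / √n * QQ n) * (√n / QQ n) := by gcongr
    rw [e]; linarith
  · intro a ha
    obtain ⟨B, hB1, hB2⟩ := exists_between ha
    have hB0 : 0 < B := hc.trans hB1
    obtain ⟨K, hK⟩ := PQ_upper hB0 (by rw [← hc2]; gcongr)
    have := (sqrt_div_QQ.const_mul K)
    rw [mul_zero] at this
    filter_upwards [hK, this.eventually (gt_mem_nhds (show 0 < a - B by linarith)),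
      eventually_gt_atTop 0] with n h1 h2 hn
    have hn0 : (0 : ℝ) < n := by exact_mod_cast hn
    have hs : 0 < √(n : ℝ) := Real.sqrt_pos.2 hn0
    have hQ := QQ_pos n
    have e : √(n : ℝ) * PP n / QQ n = B + (PP n - B / √n * QQ n) * (√n / QQ n) := by
      field_simp; ring
    have : (PP n - B / √n * QQ n) * (√n / QQ n) ≤ K * (√n / QQ n) := by gcongr
    rw [e]; linarith

lemma Pp_lim : Tendsto (fun n : ℕ => PP n / (√(n : ℝ) * pc n)) atTop (nhds (√6 / π)) := by
  have h := PQ_lim.div npc_lim (by positivity)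
  have e : π / √6 / (π ^ 2 / 6) = √6 / π := by
    have h6 : √6 ^ 2 = (6 : ℝ) := Real.sq_sqrt (by norm_num)
    have : (0 : ℝ) < √6 := by positivity
    field_simp
    linarith
  rw [e] at h
  refine h.congr' ?_
  filter_upwards [eventually_gt_atTop 0] with n hn
  have hn0 : (0 : ℝ) < n := by exact_mod_cast hn
  have hs : 0 < √(n : ℝ) := Real.sqrt_pos.2 hn0
  have hQ := QQ_pos n
  have hp := pc_pos n
  have hss : √(n : ℝ) ^ 2 = n := Real.sq_sqrt hn0.le
  simp only [Pi.div_apply]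
  field_simp
  rw [hss, mul_comm]

lemma Qp_lim : Tendsto (fun n : ℕ => QQ n / ((n : ℝ) * pc n)) atTop (nhds (π ^ 2 / 6)⁻¹) := by
  refine (npc_lim.inv₀ (by positivity)).congr fun n => ?_
  rw [inv_div]

lemma Msum_sum (k : ℕ) (hk0 : 0 < k) (n : ℕ) :
    ∑ μ : Nat.Partition n, (Msum 2 k μ.parts : ℝ) =
      LL n (fun x => ∑ j ∈ Finset.range (n + 1),
        ((k * 2 ^ j : ℕ) : ℝ) * ((x / (k * 2 ^ j) : ℕ) : ℝ)) := by
  classical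
  have h := @sum_filter_LL n (fun a : ℕ => ∃ j : ℕ, a = k * 2 ^ j)
    (Classical.decPred fun a : ℕ => ∃ j : ℕ, a = k * 2 ^ j)
  unfold Msum
  refine h.trans (LL_congr fun x hx => ?_)
  have hinj : Set.InjOn (fun j : ℕ => k * 2 ^ j) (Finset.range (n + 1) : Set ℕ) := by
    intro i _ j _ hij
    exact Nat.pow_right_injective le_rfl (Nat.eq_of_mul_eq_mul_left hk0 hij)
  rw [← Finset.sum_image (f := fun a : ℕ => (a : ℝ) * ((x / a : ℕ) : ℝ)) hinj]
  refine Finset.sum_subset ?_ ?_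
  · intro a ha
    simp only [Finset.mem_filter, Finset.mem_Icc] at ha
    obtain ⟨⟨h1, h2⟩, j, rfl⟩ := ha
    refine Finset.mem_image.2 ⟨j, ?_, rfl⟩
    rw [Finset.mem_range]
    have := Nat.lt_two_pow_self (n := j)
    nlinarith
  · intro a ha hna
    obtain ⟨j, hj, rfl⟩ := Finset.mem_image.1 ha
    have : n < k * 2 ^ j := by
      by_contra hcon
      apply hna
      simp only [Finset.mem_filter, Finset.mem_Icc]
      exact ⟨⟨Nat.mul_pos hk0 (by positivity), not_lt.1 hcon⟩, j, rfl⟩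
    rw [Nat.div_eq_of_lt (by omega)]; simp

lemma fl_upper (a x : ℕ) : (a : ℝ) * ((x / a : ℕ) : ℝ) ≤ (x : ℝ) + 1 := by
  have : (a : ℝ) * ((x / a : ℕ) : ℝ) ≤ x := by exact_mod_cast Nat.mul_div_le x a
  linarith

lemma fl_lower {a : ℕ} (ha : 0 < a) (x : ℕ) :
    (x : ℝ) + 1 - a ≤ (a : ℝ) * ((x / a : ℕ) : ℝ) := by
  have := Nat.lt_div_mul_add (a := x) ha
  have : (x : ℝ) + 1 ≤ ((x / a : ℕ) : ℝ) * a + a := by exact_mod_cast this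
  linarith

lemma fl_tail {a : ℕ} (ha : 0 < a) (x : ℕ) :
    (a : ℝ) * ((x / a : ℕ) : ℝ) ≤ 2 * TT x / a := by
  have ha' : (0 : ℝ) < a := by exact_mod_cast ha
  rcases lt_or_ge x a with h | h
  · rw [Nat.div_eq_of_lt h]
    have := TT_pos x
    simp only [Nat.cast_zero, mul_zero]
    positivity
  · rw [le_div_iff₀ ha']
    have h1 := fl_upper a x
    have h2 : (a : ℝ) ≤ x := by exact_mod_cast h
    unfold TT
    have : (0 : ℝ) ≤ (a : ℝ) * ((x / a : ℕ) : ℝ) := by positivity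
    nlinarith

lemma avg_lower (k : ℕ) (hk0 : 0 < k) (n J : ℕ) (hJ : J ≤ n + 1) :
    (J : ℝ) * PP n - k * 2 ^ J * pc n ≤ ∑ μ : Nat.Partition n, (Msum 2 k μ.parts : ℝ) := by
  rw [Msum_sum k hk0]
  have : LL n (fun x => (J : ℝ) * ((x : ℝ) + 1)) ≤
      LL n (fun x => (∑ j ∈ Finset.range (n + 1),
        ((k * 2 ^ j : ℕ) : ℝ) * ((x / (k * 2 ^ j) : ℕ) : ℝ)) + (k * 2 ^ J) * 1) := by
    refine LL_mono fun x _ => ?_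
    have h1 : ∑ j ∈ Finset.range J, ((x : ℝ) + 1 - ((k * 2 ^ j : ℕ) : ℝ)) ≤
        ∑ j ∈ Finset.range (n + 1), ((k * 2 ^ j : ℕ) : ℝ) * ((x / (k * 2 ^ j) : ℕ) : ℝ) :=
      (Finset.sum_le_sum fun j _ => fl_lower (Nat.mul_pos hk0 (by positivity)) x).trans
        (Finset.sum_le_sum_of_subset_of_nonneg (Finset.range_mono hJ)
          fun _ _ _ => by positivity)
    have h2 : ∑ j ∈ Finset.range J, ((k * 2 ^ j : ℕ) : ℝ) ≤ k * 2 ^ J := by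
      push_cast
      rw [← Finset.mul_sum]
      have : ∑ j ∈ Finset.range J, (2 : ℝ) ^ j ≤ 2 ^ J := by
        rw [geom_sum_eq (by norm_num)]; norm_num
      gcongr
    rw [Finset.sum_sub_distrib] at h1
    simp only [Finset.sum_const, Finset.card_range, nsmul_eq_mul] at h1
    linarith
  rw [LL_add, LL_smul, LL_smul, LL_one] at this
  unfold PP
  linarith

lemma avg_upper (k : ℕ) (hk0 : 0 < k) (n J : ℕ) (hJ : J ≤ n + 1) :
    ∑ μ : Nat.Partition n, (Msum 2 k μ.parts : ℝ) ≤ (J : ℝ) * PP n + 4 / 2 ^ J * QQ n := by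
  rw [Msum_sum k hk0]
  have : LL n (fun x => ∑ j ∈ Finset.range (n + 1),
        ((k * 2 ^ j : ℕ) : ℝ) * ((x / (k * 2 ^ j) : ℕ) : ℝ)) ≤
      LL n (fun x => (J : ℝ) * ((x : ℝ) + 1) + 4 / 2 ^ J * TT x) := by
    refine LL_mono fun x _ => ?_
    obtain ⟨N, hN⟩ := Nat.exists_eq_add_of_le hJ
    rw [hN, Finset.sum_range_add]
    refine add_le_add ?_ ?_
    · refine (Finset.sum_le_sum fun j _ => fl_upper _ x).trans ?_
      simp [mul_add]
    · have h1 : ∀ i ∈ Finset.range N, ((k * 2 ^ (J + i) : ℕ) : ℝ) *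
          ((x / (k * 2 ^ (J + i)) : ℕ) : ℝ) ≤ 2 * TT x / 2 ^ J * (1 / 2) ^ i := by
        intro i _
        refine (fl_tail (Nat.mul_pos hk0 (by positivity)) x).trans ?_
        have hT := TT_pos x
        have hk1 : (1 : ℝ) ≤ k := by exact_mod_cast hk0
        rw [one_div, inv_pow, ← div_eq_mul_inv, div_div, ← pow_add]
        push_cast
        apply div_le_div_of_nonneg_left (by positivity) (by positivity)
        have : (0 : ℝ) < 2 ^ (J + i) := by positivity
        nlinarith
      refine (Finset.sum_le_sum h1).trans ?_
      rw [← Finset.mul_sum]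
      have hT := TT_pos x
      calc _ ≤ 2 * TT x / 2 ^ J * 2 := by
            gcongr; exact sum_geometric_two_le N
        _ = _ := by ring
  rw [LL_add, LL_smul, LL_smul] at this
  exact this

lemma J_lim : Tendsto (fun n : ℕ => ((Nat.log 2 n / 2 : ℕ) : ℝ) / Real.log n) atTop
    (nhds (1 / (2 * Real.log 2))) := by
  have hl2 : 0 < Real.log 2 := Real.log_pos (by norm_num)
  have hlog : Tendsto (fun n : ℕ => Real.log n) atTop atTop :=
    Real.tendsto_log_atTop.comp tendsto_natCast_atTop_atTop
  have hinv := hlog.inv_tendsto_atTop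
  have hlow : Tendsto (fun n : ℕ => 1 / (2 * Real.log 2) - (Real.log n)⁻¹) atTop
      (nhds (1 / (2 * Real.log 2))) := by
    simpa using tendsto_const_nhds.sub hinv
  refine tendsto_of_tendsto_of_tendsto_of_le_of_le' hlow tendsto_const_nhds ?_ ?_
  all_goals
    filter_upwards [eventually_gt_atTop 1] with n hn
    have hn1 : (1 : ℝ) < n := by exact_mod_cast hn
    have hL : 0 < Real.log n := Real.log_pos hn1
    have e1 : 2 ^ (2 * (Nat.log 2 n / 2)) ≤ n :=
      (Nat.pow_le_pow_right (by norm_num) (by omega)).trans (Nat.pow_log_le_self 2 (by omega))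
    have e2 : n ≤ 2 ^ (2 * (Nat.log 2 n / 2) + 2) :=
      (Nat.lt_pow_succ_log_self (by norm_num) n).le.trans
        (Nat.pow_le_pow_right (by norm_num) (by omega))
    generalize Nat.log 2 n / 2 = J at e1 e2 ⊢
    have f1 : (2 : ℝ) ^ (2 * J) ≤ n := by exact_mod_cast e1
    have f2 : (n : ℝ) ≤ 2 ^ (2 * J + 2) := by exact_mod_cast e2
    have g1 := Real.log_le_log (by positivity) f1
    have g2 := Real.log_le_log (by linarith) f2
    rw [Real.log_pow] at g1 g2
    push_cast at g1 g2
  · rw [sub_le_iff_le_add, inv_eq_one_div, ← add_div, div_le_div_iff₀ (by positivity) hL]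
    linarith
  · rw [div_le_div_iff₀ hL (by positivity)]
    linarith

/-- For `p = 2` and fixed odd `k`,
`E_{μ⊢n} M_μ^{(k)} = (√6/(2π log 2))·√n·log n·(1 + o(1))` as `n → ∞`. -/
theorem average_Msum (k : ℕ) (hk0 : 0 < k) (hk : Odd k) :
    Tendsto
      (fun n : ℕ =>
        ((∑ μ : Nat.Partition n, (Msum 2 k μ.parts : ℝ)) / Nat.card (Nat.Partition n)) /
          (Real.sqrt 6 / (2 * π * Real.log 2) * Real.sqrt n * Real.log n))
      atTop (nhds 1) := by
  have hl2 : 0 < Real.log 2 := Real.log_pos (by norm_num)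
  set c := Real.sqrt 6 / (2 * π * Real.log 2) with hc
  have hc0 : 0 < c := by positivity
  have hinv : Tendsto (fun n : ℕ => (Real.log n)⁻¹) atTop (nhds 0) :=
    (Real.tendsto_log_atTop.comp tendsto_natCast_atTop_atTop).inv_tendsto_atTop
  have hmain := J_lim.mul Pp_lim
  have hlow := (hmain.sub (hinv.const_mul (k : ℝ))).div_const c
  have hupp := (hmain.add ((Qp_lim.mul hinv).const_mul 8)).div_const c
  have hval : 1 / (2 * Real.log 2) * (√6 / π) = c := by
    rw [hc]; field_simp
  rw [hval, mul_zero, sub_zero, div_self hc0.ne'] at hlow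
  rw [hval, mul_zero, mul_zero, add_zero, div_self hc0.ne'] at hupp
  refine tendsto_of_tendsto_of_tendsto_of_le_of_le' hlow hupp ?_ ?_
  all_goals
    filter_upwards [eventually_gt_atTop 1] with n hn
    have hn1 : (1 : ℝ) < n := by exact_mod_cast hn
    have hL : 0 < Real.log n := Real.log_pos hn1
    have hp := pc_pos n
    have hQ := QQ_pos n
    have hs : 0 < √(n : ℝ) := Real.sqrt_pos.2 (by linarith)
    have hss : √(n : ℝ) ^ 2 = n := Real.sq_sqrt (by linarith)
    have e1 : 2 ^ (2 * (Nat.log 2 n / 2)) ≤ n :=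
      (Nat.pow_le_pow_right (by norm_num) (by omega)).trans (Nat.pow_log_le_self 2 (by omega))
    have e2 : n ≤ 2 ^ (2 * (Nat.log 2 n / 2) + 2) :=
      (Nat.lt_pow_succ_log_self (by norm_num) n).le.trans
        (Nat.pow_le_pow_right (by norm_num) (by omega))
    have hJn : Nat.log 2 n / 2 ≤ n + 1 := by
      have := Nat.log_le_self 2 n
      omega
    have hlo := avg_lower k hk0 n _ hJn
    have hup := avg_upper k hk0 n _ hJn
    have hcard : (Nat.card (Nat.Partition n) : ℝ) = pc n := by
      rw [Nat.card_eq_fintype_card]; rfl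
    rw [hcard]
    generalize Nat.log 2 n / 2 = J at e1 e2 hlo hup ⊢
    generalize ∑ μ : Nat.Partition n, (Msum 2 k μ.parts : ℝ) = M at hlo hup ⊢
    have f1 : ((2 : ℝ) ^ J) ^ 2 ≤ n := by rw [← pow_mul, mul_comm]; exact_mod_cast e1
    have f2 : (n : ℝ) ≤ (2 * 2 ^ J) ^ 2 := by
      rw [← pow_succ', ← pow_mul]
      have : (J + 1) * 2 = 2 * J + 2 := by ring
      rw [this]; exact_mod_cast e2
    have g1 : (2 : ℝ) ^ J ≤ √n := Real.le_sqrt_of_sq_le f1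
    have g2 : √n ≤ 2 * (2 : ℝ) ^ J := Real.sqrt_le_iff.2 ⟨by positivity, f2⟩
    have hrw : M / pc n / (c * √n * Real.log n) = M / (pc n * √n * Real.log n) / c := by
      field_simp
    rw [hrw]
    apply div_le_div_of_nonneg_right _ hc0.le
  · have e : (J : ℝ) / Real.log n * (PP n / (√n * pc n)) - k * (Real.log n)⁻¹ =
        (J * PP n - k * √n * pc n) / (pc n * √n * Real.log n) := by
      field_simp
    rw [e]
    apply div_le_div_of_nonneg_right _ (by positivity)
    refine le_trans ?_ hlo
    have : (k : ℝ) * 2 ^ J * pc n ≤ k * √n * pc n := by gcongr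
    linarith
  · have e : (J : ℝ) / Real.log n * (PP n / (√n * pc n)) +
        8 * (QQ n / (n * pc n) * (Real.log n)⁻¹) =
        (J * PP n + 8 / √n * QQ n) / (pc n * √n * Real.log n) := by
      have hq : QQ n / ((n : ℝ) * pc n) = QQ n / (√n ^ 2 * pc n) := by rw [hss]
      rw [hq]
      field_simp
    rw [e]
    apply div_le_div_of_nonneg_right _ (by positivity)
    refine hup.trans ?_
    have h4 : (4 : ℝ) / 2 ^ J ≤ 8 / √n := by
      rw [div_le_div_iff₀ (by positivity) hs]; linarith
    have : (4 : ℝ) / 2 ^ J * QQ n ≤ 8 / √n * QQ n := by gcongr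
    linarith
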